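/- arXiv:0705.0732 — 2 statements merged into one kernel-verified Lean document; each statement's English description precedes it below -/
import Mathlib

section
/- Euler's constant γ satisfies γ = ∫₀^∞ ( Σ_{k=2}^{∞} 1/(k² · C(t+k,k)) ) dt, where for real t ≥ 0 and integer k ≥ 2 the generalized binomial coefficient is C(t+k,k) := Γ(t+k+1)/(Γ(k+1)·Γ(t+1)), and the inner series converges for every t ≥ 0. -/
open MeasureTheory

/-- The generalized binomial coefficient `C(t+k, k) = Γ(t+k+1)/(Γ(k+1)·Γ(t+1))`. -/
noncomputable def genBinom (t : ℝ) (k : ℕ) : ℝ :=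
  Real.Gamma (t + k + 1) / (Real.Gamma (k + 1) * Real.Gamma (t + 1))

/-- The Beta-function value `B(k+1, t+1)`, in terms of the Gamma function. -/
noncomputable def betaSucc (k : ℕ) (t : ℝ) : ℝ :=
  Real.Gamma (k + 1) * Real.Gamma (t + 1) / Real.Gamma (t + k + 2)

lemma betaSucc_pos (k : ℕ) {t : ℝ} (ht : 0 ≤ t) : 0 < betaSucc k t := by
  unfold betaSucc
  have h1 : 0 < Real.Gamma ((k : ℝ) + 1) := Real.Gamma_pos_of_pos (by positivity)
  have h2 : 0 < Real.Gamma (t + 1) := Real.Gamma_pos_of_pos (by positivity)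
  have h3 : 0 < Real.Gamma (t + k + 2) := Real.Gamma_pos_of_pos (by positivity)
  positivity

lemma betaSucc_zero {t : ℝ} (ht : 0 ≤ t) : betaSucc 0 t = 1 / (t + 1) := by
  have h2 : 0 < Real.Gamma (t + 1) := Real.Gamma_pos_of_pos (by positivity)
  have h3 : Real.Gamma (t + 2) = (t + 1) * Real.Gamma (t + 1) := by
    rw [← Real.Gamma_add_one (by positivity)]; ring_nf
  simp only [betaSucc, Nat.cast_zero, zero_add, add_zero, Real.Gamma_one, one_mul, h3]
  field_simp

lemma betaSucc_succ (k : ℕ) {t : ℝ} (ht : 0 ≤ t) :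
    betaSucc (k + 1) t = (k + 1) / (t + k + 2) * betaSucc k t := by
  have h1 : Real.Gamma ((k : ℝ) + 1 + 1) = (k + 1) * Real.Gamma (k + 1) :=
    Real.Gamma_add_one (by positivity)
  have h3 : Real.Gamma (t + (k + 1) + 2) = (t + k + 2) * Real.Gamma (t + k + 2) := by
    rw [← Real.Gamma_add_one (by positivity)]; ring_nf
  have h4 : 0 < Real.Gamma (t + k + 2) := Real.Gamma_pos_of_pos (by positivity)
  simp only [betaSucc, Nat.cast_add, Nat.cast_one, h1, h3]
  field_simp

lemma betaSucc_add_one (k : ℕ) {t : ℝ} (ht : 0 ≤ t) :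
    betaSucc k (t + 1) = (t + 1) / (t + k + 2) * betaSucc k t := by
  have h1 : Real.Gamma (t + 1 + 1) = (t + 1) * Real.Gamma (t + 1) :=
    Real.Gamma_add_one (by positivity)
  have h3 : Real.Gamma (t + 1 + k + 2) = (t + k + 2) * Real.Gamma (t + k + 2) := by
    rw [← Real.Gamma_add_one (by positivity)]; ring_nf
  have h4 : 0 < Real.Gamma (t + k + 2) := Real.Gamma_pos_of_pos (by positivity)
  simp only [betaSucc, h1, h3]
  field_simp

lemma betaSucc_sub_betaSucc_succ (k : ℕ) {t : ℝ} (ht : 0 ≤ t) :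
    betaSucc k t - betaSucc (k + 1) t = betaSucc k (t + 1) := by
  rw [betaSucc_succ k ht, betaSucc_add_one k ht]
  field_simp
  ring

lemma betaSucc_le (k : ℕ) {t : ℝ} (ht : 0 ≤ t) : betaSucc k t ≤ 1 / (k + 1) := by
  induction k with
  | zero =>
    rw [betaSucc_zero ht]
    gcongr
    simpa using ht
  | succ k ih =>
    rw [betaSucc_succ k ht]
    calc (k + 1) / (t + k + 2) * betaSucc k t ≤ (k + 1) / (t + k + 2) * (1 / (k + 1)) := by gcongr
      _ = 1 / (t + k + 2) := by field_simp
      _ ≤ 1 / ((k + 1 : ℕ) + 1) := by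
        refine one_div_le_one_div_of_le (by positivity) ?_
        push_cast
        linarith

lemma hasSum_betaSucc {t : ℝ} (ht : 0 ≤ t) :
    HasSum (fun k ↦ betaSucc (k + 1) (t + 1)) (1 / ((t + 1) * (t + 2))) := by
  rw [hasSum_iff_tendsto_nat_of_nonneg (fun k ↦ (betaSucc_pos _ (by positivity)).le)]
  have hsum (n : ℕ) : ∑ k ∈ Finset.range n, betaSucc (k + 1) (t + 1) =
      1 / ((t + 1) * (t + 2)) - betaSucc (n + 1) t := by
    have h1 : betaSucc 1 t = 1 / ((t + 1) * (t + 2)) := by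
      have := betaSucc_succ 0 ht
      rw [betaSucc_zero ht] at this
      rw [zero_add] at this
      rw [this, Nat.cast_zero]
      field_simp
      ring
    rw [← h1, ← Finset.sum_range_sub' (fun k ↦ betaSucc (k + 1) t)]
    exact Finset.sum_congr rfl fun k _ ↦ (betaSucc_sub_betaSucc_succ (k + 1) ht).symm
  have hlim : Filter.Tendsto (fun n ↦ betaSucc (n + 1) t) Filter.atTop (nhds 0) :=
    squeeze_zero (fun n ↦ (betaSucc_pos _ ht).le) (fun n ↦ betaSucc_le (n + 1) ht)
      ((Filter.tendsto_add_atTop_iff_nat 1).2 tendsto_one_div_add_atTop_nhds_zero_nat)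
  simp_rw [hsum]
  simpa using hlim.const_sub (1 / ((t + 1) * (t + 2)))

lemma one_div_sq_mul_genBinom (t : ℝ) (k : ℕ) :
    1 / (((k + 2 : ℕ) : ℝ) ^ 2 * genBinom t (k + 2)) = betaSucc (k + 1) t / (k + 2) := by
  have h1 : Real.Gamma ((k : ℝ) + 2 + 1) = (k + 2) * Real.Gamma (k + 1 + 1) := by
    rw [Real.Gamma_add_one (by positivity)]; ring_nf
  simp only [genBinom, betaSucc, Nat.cast_add, Nat.cast_one, Nat.cast_ofNat, h1]
  rw [show t + ((k : ℝ) + 2) + 1 = t + (k + 1) + 2 by ring]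
  field_simp

lemma summable_betaSucc_div {t : ℝ} (ht : 0 ≤ t) :
    Summable fun k : ℕ ↦ betaSucc (k + 1) t / (k + 2) := by
  have h : Summable fun k : ℕ ↦ 1 / ((k + 2 : ℕ) : ℝ) ^ 2 :=
    (summable_nat_add_iff 2).2 (Real.summable_one_div_nat_pow.2 one_lt_two)
  refine h.of_nonneg_of_le (fun k ↦ ?_) (fun k ↦ ?_)
  · have := betaSucc_pos (k + 1) ht
    positivity
  · have := betaSucc_le (k + 1) ht
    push_cast at this ⊢
    rw [div_le_iff₀ (by positivity)]
    refine this.trans (le_of_eq ?_)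
    rw [show (k : ℝ) + 1 + 1 = k + 2 by ring]
    field_simp

lemma tsum_betaSucc_div_sub {t : ℝ} (ht : 0 ≤ t) :
    ∑' k : ℕ, betaSucc (k + 1) t / (k + 2) - ∑' k : ℕ, betaSucc (k + 1) (t + 1) / (k + 2) =
      1 / ((t + 1) ^ 2 * (t + 2)) := by
  rw [← (summable_betaSucc_div ht).tsum_sub (summable_betaSucc_div (by positivity))]
  have h (k : ℕ) : betaSucc (k + 1) t / (k + 2) - betaSucc (k + 1) (t + 1) / (k + 2) =
      1 / (t + 1) * betaSucc (k + 1) (t + 1) := by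
    rw [betaSucc_add_one (k + 1) ht]
    push_cast
    field_simp
    ring
  simp_rw [h]
  rw [tsum_mul_left, (hasSum_betaSucc ht).tsum_eq]
  field_simp

lemma tendsto_tsum_betaSucc_div {t : ℝ} (ht : 0 ≤ t) :
    Filter.Tendsto (fun n : ℕ ↦ ∑' k : ℕ, betaSucc (k + 1) (t + n) / (k + 2))
      Filter.atTop (nhds 0) := by
  rw [← Filter.tendsto_add_atTop_iff_nat 1]
  refine squeeze_zero (fun n ↦ tsum_nonneg fun k ↦ ?_) (fun n ↦ ?_)
    tendsto_one_div_add_atTop_nhds_zero_nat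
  · have := betaSucc_pos (k + 1) (t := t + (n + 1 : ℕ)) (by positivity)
    positivity
  · have hn : 0 ≤ t + n := by positivity
    calc ∑' k : ℕ, betaSucc (k + 1) (t + (n + 1 : ℕ)) / (k + 2)
        ≤ ∑' k : ℕ, betaSucc (k + 1) (t + n + 1) := by
          rw [Nat.cast_add_one, ← add_assoc]
          refine (summable_betaSucc_div (by positivity)).tsum_le_tsum (fun k ↦ ?_)
            (hasSum_betaSucc hn).summable
          exact div_le_self (betaSucc_pos _ (by positivity)).le (by linarith [k.cast_nonneg (α := ℝ)])
      _ = 1 / ((t + n + 1) * (t + n + 2)) := (hasSum_betaSucc hn).tsum_eq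
      _ ≤ 1 / (n + 1) := by
          gcongr
          nlinarith

lemma hasSum_tsum_betaSucc_div {t : ℝ} (ht : 0 ≤ t) :
    HasSum (fun n : ℕ ↦ 1 / ((t + n + 1) ^ 2 * (t + n + 2)))
      (∑' k : ℕ, betaSucc (k + 1) t / (k + 2)) := by
  rw [hasSum_iff_tendsto_nat_of_nonneg (fun n ↦ by positivity)]
  have hsum (N : ℕ) : ∑ n ∈ Finset.range N, 1 / ((t + n + 1) ^ 2 * (t + n + 2)) =
      ∑' k : ℕ, betaSucc (k + 1) t / (k + 2) - ∑' k : ℕ, betaSucc (k + 1) (t + N) / (k + 2) := by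
    have := Finset.sum_range_sub' (fun n : ℕ ↦ ∑' k : ℕ, betaSucc (k + 1) (t + n) / (k + 2)) N
    rw [Nat.cast_zero, add_zero] at this
    rw [← this]
    refine Finset.sum_congr rfl fun n _ ↦ ?_
    rw [← tsum_betaSucc_div_sub (by positivity), Nat.cast_add_one, ← add_assoc]
  simp_rw [hsum]
  simpa using (tendsto_tsum_betaSucc_div ht).const_sub (∑' k : ℕ, betaSucc (k + 1) t / (k + 2))

lemma hasDerivAt_log_add_one_sub_log_sub_inv {u : ℝ} (hu : 0 < u) :
    HasDerivAt (fun u : ℝ ↦ Real.log (u + 1) - Real.log u - u⁻¹) (1 / (u ^ 2 * (u + 1))) u := by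
  have h := ((((hasDerivAt_id' u).add_const 1).log (by positivity)).sub
    (Real.hasDerivAt_log hu.ne')).sub (hasDerivAt_inv hu.ne')
  refine h.congr_deriv ?_
  field_simp
  ring

lemma tendsto_log_add_one_sub_log_sub_inv :
    Filter.Tendsto (fun u : ℝ ↦ Real.log (u + 1) - Real.log u - u⁻¹) Filter.atTop (nhds 0) := by
  simpa using (Real.tendsto_log_comp_add_sub_log 1).sub tendsto_inv_atTop_zero

lemma hasDerivAt_log_sub_log_sub_inv_shift (n : ℕ) {t : ℝ} (ht : 0 ≤ t) :
    HasDerivAt (fun t : ℝ ↦ Real.log (t + (n + 1) + 1) - Real.log (t + (n + 1)) - (t + (n + 1))⁻¹)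
      (1 / ((t + n + 1) ^ 2 * (t + n + 2))) t := by
  have h := (hasDerivAt_log_add_one_sub_log_sub_inv
    (u := t + (n + 1)) (by positivity)).comp_add_const t (n + 1 : ℝ)
  exact h.congr_deriv (by ring_nf)

lemma tendsto_log_sub_log_sub_inv_shift (n : ℕ) :
    Filter.Tendsto
      (fun t : ℝ ↦ Real.log (t + (n + 1) + 1) - Real.log (t + (n + 1)) - (t + (n + 1))⁻¹)
      Filter.atTop (nhds 0) :=
  tendsto_log_add_one_sub_log_sub_inv.comp
    (Filter.tendsto_atTop_add_const_right _ (n + 1 : ℝ) Filter.tendsto_id)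

lemma integrableOn_one_div_sq_mul (n : ℕ) :
    IntegrableOn (fun t : ℝ ↦ 1 / ((t + n + 1) ^ 2 * (t + n + 2))) (Set.Ioi 0) :=
  integrableOn_Ioi_deriv_of_nonneg' (fun _ ht ↦ hasDerivAt_log_sub_log_sub_inv_shift n ht)
    (fun t ht ↦ by have : 0 < t := ht; positivity) (tendsto_log_sub_log_sub_inv_shift n)

lemma integral_one_div_sq_mul (n : ℕ) :
    ∫ t in Set.Ioi (0 : ℝ), 1 / ((t + n + 1) ^ 2 * (t + n + 2)) =
      ((n : ℝ) + 1)⁻¹ - (Real.log (n + 1 + 1) - Real.log (n + 1)) := by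
  rw [integral_Ioi_of_hasDerivAt_of_nonneg' (fun _ ht ↦ hasDerivAt_log_sub_log_sub_inv_shift n ht)
    (fun t ht ↦ by have : 0 < t := ht; positivity) (tendsto_log_sub_log_sub_inv_shift n)]
  ring_nf

lemma hasSum_inv_sub_log_eulerMascheroniConstant :
    HasSum (fun n : ℕ ↦ ((n : ℝ) + 1)⁻¹ - (Real.log (n + 1 + 1) - Real.log (n + 1)))
      Real.eulerMascheroniConstant := by
  rw [hasSum_iff_tendsto_nat_of_nonneg]
  · convert Real.tendsto_harmonic_sub_log_add_one using 2 with N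
    rw [Finset.sum_sub_distrib]
    have := Finset.sum_range_sub (fun n : ℕ ↦ Real.log (n + 1)) N
    push_cast at this
    rw [this]
    simp [harmonic]
  · intro n
    rw [← integral_one_div_sq_mul]
    refine setIntegral_nonneg measurableSet_Ioi fun t ht ↦ ?_
    have : 0 < t := ht
    positivity

theorem stmt_13 :
    (∀ t : ℝ, 0 ≤ t →
      Summable (fun k : ℕ => 1 / (((k + 2 : ℕ) : ℝ) ^ 2 * genBinom t (k + 2)))) ∧
    Real.eulerMascheroniConstant =
      ∫ t in Set.Ioi (0 : ℝ), ∑' k : ℕ, 1 / (((k + 2 : ℕ) : ℝ) ^ 2 * genBinom t (k + 2)) := by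
  simp_rw [one_div_sq_mul_genBinom]
  refine ⟨fun t ht ↦ summable_betaSucc_div ht, ?_⟩
  have hnorm (n : ℕ) : ∫ t in Set.Ioi (0 : ℝ), ‖1 / ((t + n + 1) ^ 2 * (t + n + 2))‖ =
      ((n : ℝ) + 1)⁻¹ - (Real.log (n + 1 + 1) - Real.log (n + 1)) := by
    rw [← integral_one_div_sq_mul]
    refine setIntegral_congr_fun measurableSet_Ioi fun t ht ↦ ?_
    have : 0 < t := ht
    exact Real.norm_of_nonneg (by positivity)
  have h := hasSum_integral_of_summable_integral_norm integrableOn_one_div_sq_mul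
    (by simpa only [hnorm] using hasSum_inv_sub_log_eulerMascheroniConstant.summable)
  simp_rw [integral_one_div_sq_mul] at h
  rw [hasSum_inv_sub_log_eulerMascheroniConstant.unique h]
  exact setIntegral_congr_fun measurableSet_Ioi fun t ht ↦
    (hasSum_tsum_betaSucc_div (le_of_lt ht)).tsum_eq
end

section
/- For every integer m ≥ 2, the integral K_{m,0} := ∫⋯∫_{V_m} dx₁⋯dx_m/(x₁x₂⋯x_m) over the polytope V_m := {(x₁,…,x_m) ∈ [0,1]^m : x₁ + x_j ≥ 1 for j = 2,…,m} equals (m−1)! · ζ(m), where ζ is the Riemann zeta function. -/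
open MeasureTheory

/-- The polytope `V_m = {x ∈ [0,1]^m : x₀ + x_j ≥ 1 for j ≠ 0}`. -/
def V (m : ℕ) [NeZero m] : Set (Fin m → ℝ) :=
  {x | (∀ i, x i ∈ Set.Icc (0 : ℝ) 1) ∧ ∀ j, j ≠ 0 → 1 ≤ x 0 + x j}

lemma lintegral_pow_mul_exp_neg_mul_Ioi (n : ℕ) {r : ℝ} (hr : 0 < r) :
    ∫⁻ t in Set.Ioi (0 : ℝ), ENNReal.ofReal (t ^ n * Real.exp (-(r * t))) =
      ENNReal.ofReal (n.factorial / r ^ (n + 1)) := by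
  have h : ∫ t in Set.Ioi (0 : ℝ), t ^ n * Real.exp (-(r * t)) =
      n.factorial / r ^ (n + 1) := by
    have := Real.integral_rpow_mul_exp_neg_mul_Ioi (a := (n : ℝ) + 1) (by positivity) hr
    rw [Real.Gamma_nat_eq_factorial] at this
    simp only [add_sub_cancel_right, Real.rpow_natCast] at this
    rw [this]
    norm_cast
    rw [one_div, inv_pow]
    field_simp
  rw [← ofReal_integral_eq_lintegral_ofReal, h]
  · exact Integrable.of_integral_ne_zero (by rw [h]; positivity)
  · filter_upwards [self_mem_ae_restrict measurableSet_Ioi] with t ht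
    have : 0 < t := ht
    simp only [Pi.zero_apply]
    positivity

lemma lintegral_pow_mul_exp_neg_div_one_sub_exp_neg (n : ℕ) :
    ∫⁻ t in Set.Ioi (0 : ℝ), ENNReal.ofReal (t ^ n * (Real.exp (-t) / (1 - Real.exp (-t)))) =
      ∑' k : ℕ, ENNReal.ofReal (n.factorial / ((k : ℝ) + 1) ^ (n + 1)) := by
  have h (k : ℕ) := lintegral_pow_mul_exp_neg_mul_Ioi n (r := (k : ℝ) + 1) (by positivity)
  simp_rw [← h]
  rw [← lintegral_tsum (fun k => by fun_prop)]
  refine setLIntegral_congr_fun measurableSet_Ioi fun t (ht : 0 < t) => ?_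
  have hlt : Real.exp (-t) < 1 := by simpa using ht
  have hterm (k : ℕ) : t ^ n * Real.exp (-(((k : ℝ) + 1) * t)) =
      t ^ n * Real.exp (-t) * Real.exp (-t) ^ k := by
    rw [← Real.exp_nat_mul, mul_assoc, ← Real.exp_add]
    ring_nf
  simp_rw [hterm]
  rw [← ENNReal.ofReal_tsum_of_nonneg (fun k => by positivity)
    ((summable_geometric_of_lt_one (Real.exp_nonneg _) hlt).mul_left _), tsum_mul_left,
    tsum_geometric_of_lt_one (Real.exp_nonneg _) hlt]
  ring_nf

lemma image_one_sub_exp_neg_Ioi :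
    (fun t : ℝ => 1 - Real.exp (-t)) '' Set.Ioi 0 = Set.Ioo 0 1 := by
  ext x
  constructor
  · rintro ⟨t, ht, rfl⟩
    have : 0 < t := ht
    exact ⟨by simpa using this, by simpa using Real.exp_pos (-t)⟩
  · rintro ⟨h0, h1⟩
    refine ⟨-Real.log (1 - x), ?_, ?_⟩
    · simpa using Real.log_neg (by linarith) (by linarith)
    · simp [Real.exp_log (show 0 < 1 - x by linarith)]

lemma lintegral_neg_log_one_sub_pow_div (n : ℕ) :
    ∫⁻ x in Set.Ioo (0 : ℝ) 1, ENNReal.ofReal (x⁻¹ * (-Real.log (1 - x)) ^ n) =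
      ∑' k : ℕ, ENNReal.ofReal (n.factorial / ((k : ℝ) + 1) ^ (n + 1)) := by
  rw [← lintegral_pow_mul_exp_neg_div_one_sub_exp_neg, ← image_one_sub_exp_neg_Ioi,
    lintegral_image_eq_lintegral_abs_deriv_mul measurableSet_Ioi
      (f' := fun t => Real.exp (-t))]
  · refine setLIntegral_congr_fun measurableSet_Ioi fun t ht => ?_
    simp only [sub_sub_cancel, Real.log_exp, neg_neg, Real.abs_exp]
    rw [← ENNReal.ofReal_mul (Real.exp_nonneg _)]
    ring_nf
  · intro t _
    simpa using (((hasDerivAt_id t).neg.exp).const_sub 1).hasDerivWithinAt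
  · intro s _ t _ h
    simpa using h

lemma lintegral_pi_Icc_prod_inv (n : ℕ) {a : ℝ} (ha : 0 < a) (ha1 : a ≤ 1) :
    ∫⁻ y in Set.univ.pi (fun _ : Fin n => Set.Icc a 1), ENNReal.ofReal (∏ i, (y i)⁻¹) =
      ENNReal.ofReal ((-Real.log a) ^ n) := by
  have hint : IntegrableOn (fun y : ℝ => y⁻¹) (Set.Icc a 1) :=
    (continuousOn_inv₀.mono fun y hy => (ha.trans_le hy.1).ne').integrableOn_Icc
  have hval : ∫ y in Set.Icc a 1, y⁻¹ = -Real.log a := by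
    rw [integral_Icc_eq_integral_Ioc, ← intervalIntegral.integral_of_le ha1,
      integral_inv_of_pos ha one_pos, one_div, Real.log_inv]
  rw [← ofReal_integral_eq_lintegral_ofReal]
  · rw [volume_pi, Measure.restrict_pi_pi, integral_fintype_prod_eq_pow (fun y : ℝ => y⁻¹), hval,
      Fintype.card_fin]
  · rw [volume_pi, Measure.restrict_pi_pi]
    exact Integrable.fintype_prod fun _ => hint
  · filter_upwards [self_mem_ae_restrict
      (MeasurableSet.univ_pi fun _ => measurableSet_Icc)] with y hy
    exact Finset.prod_nonneg fun i _ => inv_nonneg.2 (ha.le.trans (hy i trivial).1)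

lemma measurableSet_V (m : ℕ) [NeZero m] : MeasurableSet (V m) := by
  unfold V
  measurability

lemma lintegral_V_succ (n : ℕ) :
    ∫⁻ x in V (n + 1), ENNReal.ofReal (1 / ∏ i, x i) =
      ∑' k : ℕ, ENNReal.ofReal (n.factorial / ((k : ℝ) + 1) ^ (n + 1)) := by
  rw [← lintegral_neg_log_one_sub_pow_div, ← lintegral_indicator (measurableSet_V _),
    ← ((volume_preserving_piFinSuccAbove (fun _ : Fin (n + 1) => ℝ) 0).symm).lintegral_comp_emb
      (MeasurableEquiv.measurableEmbedding _), Measure.volume_eq_prod, lintegral_prod]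
  · rw [← lintegral_indicator measurableSet_Ioo]
    have h0 : ∀ᵐ x : ℝ, x ≠ 0 := Measure.ae_ne volume 0
    have h1 : ∀ᵐ x : ℝ, x ≠ 1 := Measure.ae_ne volume 1
    refine lintegral_congr_ae ?_
    filter_upwards [h0, h1] with x hx0 hx1
    have hcons (y : Fin n → ℝ) :
        (MeasurableEquiv.piFinSuccAbove (fun _ : Fin (n + 1) => ℝ) 0).symm (x, y) =
          (Fin.cons x y : Fin (n + 1) → ℝ) := by
      simp [MeasurableEquiv.piFinSuccAbove, Fin.consEquiv]
    have hmem (y : Fin n → ℝ) :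
        (MeasurableEquiv.piFinSuccAbove (fun _ : Fin (n + 1) => ℝ) 0).symm (x, y) ∈ V (n + 1) ↔
          x ∈ Set.Ioo (0 : ℝ) 1 ∧ y ∈ Set.univ.pi (fun _ : Fin n => Set.Icc (1 - x) 1) := by
      rw [hcons]
      simp only [V, Set.mem_ofPred_eq, Fin.forall_fin_succ, Fin.cons_zero, Fin.cons_succ,
        Set.mem_Icc, Set.mem_Ioo, Set.mem_univ_pi]
      constructor
      · rintro ⟨⟨⟨h0, h1⟩, h2⟩, -, h3⟩
        exact ⟨⟨h0.lt_of_ne' hx0, h1.lt_of_ne hx1⟩, fun i =>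
          ⟨by linarith [h3 i (Fin.succ_ne_zero i)], (h2 i).2⟩⟩
      · rintro ⟨⟨h0, h1⟩, h2⟩
        exact ⟨⟨⟨h0.le, h1.le⟩, fun i => ⟨by linarith [(h2 i).1], (h2 i).2⟩⟩,
          fun h => absurd rfl h, fun i _ => by linarith [(h2 i).1]⟩
    by_cases hx : x ∈ Set.Ioo (0 : ℝ) 1
    · rw [Set.indicator_of_mem hx, ENNReal.ofReal_mul (inv_nonneg.2 hx.1.le),
        ← lintegral_pi_Icc_prod_inv n (a := 1 - x) (by linarith [hx.2]) (by linarith [hx.1]),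
        ← lintegral_const_mul' _ _ ENNReal.ofReal_ne_top,
        ← lintegral_indicator (MeasurableSet.univ_pi fun _ => measurableSet_Icc)]
      refine lintegral_congr fun y => ?_
      by_cases hy : y ∈ Set.univ.pi (fun _ : Fin n => Set.Icc (1 - x) 1)
      · rw [Set.indicator_of_mem ((hmem y).2 ⟨hx, hy⟩), Set.indicator_of_mem hy,
          ← ENNReal.ofReal_mul (inv_nonneg.2 hx.1.le)]
        simp [hcons, Fin.prod_univ_succ, mul_comm]
      · rw [Set.indicator_of_notMem (fun h => hy ((hmem y).1 h).2), Set.indicator_of_notMem hy]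
    · rw [Set.indicator_of_notMem hx]
      refine (lintegral_congr fun y => ?_).trans lintegral_zero
      exact Set.indicator_of_notMem (fun h => hx ((hmem y).1 h).1) _
  · have hmeas : Measurable ((V (n + 1)).indicator
        fun x : Fin (n + 1) → ℝ => ENNReal.ofReal (1 / ∏ i, x i)) :=
      Measurable.indicator (by fun_prop) (measurableSet_V _)
    exact (hmeas.comp (MeasurableEquiv.measurable _)).aemeasurable

theorem stmt_16 (m : ℕ) [NeZero m] (hm : 2 ≤ m) :
    ((∫ x in V m, 1 / ∏ i, x i : ℝ) : ℂ) =
      (Nat.factorial (m - 1) : ℂ) * riemannZeta m := by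
  obtain ⟨n, rfl⟩ : ∃ n, m = n + 1 := ⟨m - 1, by omega⟩
  have hsum : Summable fun k : ℕ => (n.factorial : ℝ) / ((k : ℝ) + 1) ^ (n + 1) := by
    have := (summable_nat_add_iff 1).2 (Real.summable_one_div_nat_pow.2 (show 1 < n + 1 by omega))
    simpa [div_eq_mul_inv] using this.mul_left (n.factorial : ℝ)
  have hreal : ∫ x in V (n + 1), 1 / ∏ i, x i =
      ∑' k : ℕ, (n.factorial : ℝ) / ((k : ℝ) + 1) ^ (n + 1) := by
    rw [integral_eq_lintegral_of_nonneg_ae]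
    · refine (congrArg ENNReal.toReal (lintegral_V_succ n)).trans ?_
      rw [← ENNReal.ofReal_tsum_of_nonneg (fun k => by positivity) hsum,
        ENNReal.toReal_ofReal (tsum_nonneg fun k => by positivity)]
    · filter_upwards [self_mem_ae_restrict (measurableSet_V (n + 1))] with x hx
      exact one_div_nonneg.2 (Finset.prod_nonneg fun i _ => (hx.1 i).1)
    · exact Measurable.aestronglyMeasurable (by fun_prop)
  rw [hreal, zeta_eq_tsum_one_div_nat_add_one_cpow (by simpa using by omega), ← tsum_mul_left,
    Complex.ofReal_tsum]
  refine tsum_congr fun k => ?_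
  rw [Complex.cpow_natCast]
  push_cast
  simp [div_eq_mul_inv]
end
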